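/- Let a_n denote the number of conjugacy classes of n×n matrices over 𝔽_q. Then the sequence a_n/q^n converges as n → ∞ and lim_{n→∞} a_n/q^n = ∏_{r≥1} (1 − q^{−r})^{−1} (the reciprocal of an infinite product of real numbers). -/

import Mathlib

/-- The number of conjugacy (similarity) classes of `n × n` matrices over the field `F`. -/
noncomputable def conjClassCount (F : Type) [Field F] [Fintype F] (n : ℕ) : ℕ :=
  Nat.card (Quot fun A B : Matrix (Fin n) (Fin n) F =>
    ∃ P : Matrix (Fin n) (Fin n) F, IsUnit P ∧ B = P * A * P⁻¹)

open Polynomial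

/-- The monic irreducible polynomials over `F`. -/
abbrev MonicIrreducible (F : Type) [Field F] : Type := {p : F[X] // p.Monic ∧ Irreducible p}

/-- The quotient of `F[X]` by the `(k + 1)`-st power of the polynomial `p`, for `x = (k, p)`. -/
abbrev PrimaryQuotient {F : Type} [Field F] (x : ℕ × MonicIrreducible F) : Type :=
  F[X] ⧸ Ideal.span {(x.2 : F[X]) ^ (x.1 + 1)}

open scoped Classical in
/-- The torsion `F[X]`-module with multiset of elementary divisors `S`. -/
abbrev ElementaryModule {F : Type} [Field F] (S : Multiset (ℕ × MonicIrreducible F)) : Type :=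
  ∀ x : S, PrimaryQuotient x.1

/-- The matrix `A` acts as multiplication by `X` on the module with elementary divisors `S`. -/
def HasElementaryDivisors {F : Type} [Field F] {n : ℕ} (A : Matrix (Fin n) (Fin n) F)
    (S : Multiset (ℕ × MonicIrreducible F)) : Prop :=
  ∃ e : (Fin n → F) ≃ₗ[F] ElementaryModule S, ∀ v, e (A.mulVec v) = (X : F[X]) • e v

section Divisors

variable {F : Type} [Field F]

lemma natCard_quotient_span [Finite F] {f : F[X]} (hf : f ≠ 0) :
    Nat.card (F[X] ⧸ Ideal.span {f}) = Nat.card F ^ f.natDegree := by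
  have : Module.Finite F (F[X] ⧸ Ideal.span {f}) := (AdjoinRoot.powerBasis hf).finite
  rw [Module.natCard_eq_pow_finrank (K := F), finrank_quotient_span_eq_natDegree]

lemma PrimaryQuotient.moduleFinite (x : ℕ × MonicIrreducible F) :
    Module.Finite F (PrimaryQuotient x) :=
  (AdjoinRoot.powerBasis (pow_ne_zero _ x.2.2.2.ne_zero)).finite

lemma natCard_primaryQuotient [Finite F] (x : ℕ × MonicIrreducible F) :
    Nat.card (PrimaryQuotient x) = Nat.card F ^ ((x.1 + 1) * x.2.1.natDegree) := by
  rw [natCard_quotient_span (pow_ne_zero _ x.2.2.2.ne_zero), natDegree_pow]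

/-- The dimension of the module with elementary divisors `S`. -/
def totalDegree (S : Multiset (ℕ × MonicIrreducible F)) : ℕ :=
  (S.map fun x => (x.1 + 1) * x.2.1.natDegree).sum

lemma ElementaryModule.moduleFinite (S : Multiset (ℕ × MonicIrreducible F)) :
    Module.Finite F (ElementaryModule S) := by
  have := fun x : ℕ × MonicIrreducible F => PrimaryQuotient.moduleFinite x
  infer_instance

lemma prod_pow_eq_pow_sum_map {α : Type*} [DecidableEq α] (S : Multiset α) (f : α → ℕ) (q : ℕ) :
    ∏ x : S, q ^ f x.1 = q ^ (S.map f).sum := by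
  rw [Finset.prod_pow_eq_pow_sum, Finset.sum, Multiset.map_univ]

lemma natCard_elementaryModule [Finite F] (S : Multiset (ℕ × MonicIrreducible F)) :
    Nat.card (ElementaryModule S) = Nat.card F ^ totalDegree S := by
  classical
  rw [Nat.card_pi]
  simp_rw [natCard_primaryQuotient]
  exact prod_pow_eq_pow_sum_map S (fun x => (x.1 + 1) * x.2.1.natDegree) _

lemma HasElementaryDivisors.totalDegree_eq [Finite F] {n : ℕ} {A : Matrix (Fin n) (Fin n) F}
    {S : Multiset (ℕ × MonicIrreducible F)} (h : HasElementaryDivisors A S) :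
    totalDegree S = n := by
  obtain ⟨e, -⟩ := h
  have h := Nat.card_congr e.toEquiv
  rw [natCard_elementaryModule, Nat.card_fun, Nat.card_fin] at h
  exact (Nat.pow_right_injective Finite.one_lt_card h).symm

lemma exists_hasElementaryDivisors [Finite F] (S : Multiset (ℕ × MonicIrreducible F)) {n : ℕ}
    (hS : totalDegree S = n) :
    ∃ A : Matrix (Fin n) (Fin n) F, HasElementaryDivisors A S := by
  have := ElementaryModule.moduleFinite S
  have hn : Module.finrank F (ElementaryModule S) = n := by
    have h := Module.natCard_eq_pow_finrank (K := F) (V := ElementaryModule S)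
    rw [natCard_elementaryModule, hS] at h
    exact (Nat.pow_right_injective Finite.one_lt_card h).symm
  let e : (Fin n → F) ≃ₗ[F] ElementaryModule S := LinearEquiv.ofFinrankEq _ _ (by simp [hn])
  let φ : ElementaryModule S →ₗ[F] ElementaryModule S :=
    LinearMap.restrictScalars F (LinearMap.lsmul F[X] (ElementaryModule S) X)
  refine ⟨LinearMap.toMatrix' (e.symm.toLinearMap ∘ₗ φ ∘ₗ e.toLinearMap), e, fun v => ?_⟩
  rw [LinearMap.toMatrix'_mulVec]
  simp [φ]

lemma HasElementaryDivisors.conj {n : ℕ} {A B : Matrix (Fin n) (Fin n) F}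
    {S : Multiset (ℕ × MonicIrreducible F)} (hA : HasElementaryDivisors A S)
    (h : ∃ P : Matrix (Fin n) (Fin n) F, IsUnit P ∧ B = P * A * P⁻¹) :
    HasElementaryDivisors B S := by
  obtain ⟨e, he⟩ := hA
  obtain ⟨P, hP, rfl⟩ := h
  have hd := (Matrix.isUnit_iff_isUnit_det _).1 hP
  have h₁ := Matrix.mul_nonsing_inv P hd
  have h₂ := Matrix.nonsing_inv_mul P hd
  refine ⟨(Matrix.toLin'OfInv h₁ h₂).trans e, fun v => ?_⟩
  change e (P⁻¹.mulVec ((P * A * P⁻¹).mulVec v)) = (X : F[X]) • e (P⁻¹.mulVec v)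
  rw [← he, Matrix.mulVec_mulVec, Matrix.mulVec_mulVec, mul_assoc,
    Matrix.nonsing_inv_mul_cancel_left _ _ hd]

lemma HasElementaryDivisors.exists_conj {n : ℕ} {A B : Matrix (Fin n) (Fin n) F}
    {S : Multiset (ℕ × MonicIrreducible F)} (hA : HasElementaryDivisors A S)
    (hB : HasElementaryDivisors B S) :
    ∃ P : Matrix (Fin n) (Fin n) F, IsUnit P ∧ B = P * A * P⁻¹ := by
  obtain ⟨e, he⟩ := hA
  obtain ⟨f, hf⟩ := hB
  let g := e.trans f.symm
  have hg : LinearMap.toMatrix' g.symm.toLinearMap * LinearMap.toMatrix' g.toLinearMap = 1 := by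
    rw [← LinearMap.toMatrix'_comp]; simp
  have hg' := mul_eq_one_comm.1 hg
  refine ⟨LinearMap.toMatrix' g.toLinearMap, .of_mul_eq_one _ hg', ?_⟩
  rw [Matrix.inv_eq_left_inv hg]
  have key : B * LinearMap.toMatrix' g.toLinearMap = LinearMap.toMatrix' g.toLinearMap * A := by
    apply Matrix.toLin'.injective
    refine LinearMap.ext fun v => ?_
    simp only [Matrix.toLin'_mul, LinearMap.comp_apply, Matrix.toLin'_apply,
      LinearMap.toMatrix'_mulVec, LinearEquiv.coe_coe]
    apply f.injective
    rw [hf]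
    simp [g, he]
  rw [← key, mul_assoc, hg', mul_one]

lemma exists_elementaryModule_equiv {ι : Type*} [Finite ι] (x : ι → ℕ × MonicIrreducible F) :
    ∃ S : Multiset (ℕ × MonicIrreducible F),
      Nonempty ((∀ i, PrimaryQuotient (x i)) ≃ₗ[F[X]] ElementaryModule S) := by
  classical
  have := Fintype.ofFinite ι
  let S : Multiset (ℕ × MonicIrreducible F) := Finset.univ.val.map x
  have hcard (y : ℕ × MonicIrreducible F) :
      Fintype.card {i // x i = y} = Fintype.card (Fin (S.count y)) := by
    rw [Fintype.card_fin, Multiset.count_map, Fintype.card_subtype]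
    simp only [eq_comm]
    rfl
  let σ : (Σ y, {i // x i = y}) ≃ S :=
    Equiv.sigmaCongrRight fun y => Fintype.equivOfCardEq (hcard y)
  let τ : S ≃ ι := σ.symm.trans (Equiv.sigmaFiberEquiv x)
  have hτ (s : S) : x (τ s) = s := (σ.symm s).2.2
  refine ⟨S, ⟨(LinearEquiv.piCongrLeft' F[X] (fun i => PrimaryQuotient (x i)) τ.symm).trans
    (LinearEquiv.piCongrRight fun s => Submodule.quotEquivOfEq _ _ ?_)⟩⟩
  simp only [Equiv.symm_symm]
  rw [hτ]

lemma exists_elementaryDivisors {n : ℕ} (A : Matrix (Fin n) (Fin n) F) :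
    ∃ S, HasElementaryDivisors A S := by
  classical
  let M := Module.AEval' (Matrix.toLin' A)
  have : Module.Finite F[X] M := inferInstance
  have hM : Module.IsTorsion F[X] M := Module.AEval.isTorsion_of_finiteDimensional F _ _
  obtain ⟨ι, _, p, hp, e, ⟨g⟩⟩ := Module.equiv_directSum_of_isTorsion hM
  let g₁ := g.trans (DirectSum.linearEquivFunOnFintype F[X] ι _)
  let x (i : {i // e i ≠ 0}) : ℕ × MonicIrreducible F :=
    (e i - 1, ⟨normalize (p i), monic_normalize (hp i).ne_zero,
      (normalize_associated (p i)).symm.irreducible (hp i)⟩)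
  have hx (i : {i // e i ≠ 0}) :
      F[X] ∙ p i ^ e i = Ideal.span {((x i).2 : F[X]) ^ ((x i).1 + 1)} := by
    simp only [x, Nat.sub_add_cancel (Nat.one_le_iff_ne_zero.2 i.2)]
    exact Ideal.span_singleton_eq_span_singleton.2 ((normalize_associated (p i)).symm.pow_pow)
  have hsub (i : {i // ¬ e i ≠ 0}) : Subsingleton (F[X] ⧸ F[X] ∙ p i ^ e i) := by
    refine Ideal.Quotient.subsingleton_iff.2 ?_
    rw [not_not.1 i.2, pow_zero]
    exact Ideal.span_singleton_one
  let g₂ : (∀ i, F[X] ⧸ F[X] ∙ p i ^ e i) ≃ₗ[F[X]] ∀ i, PrimaryQuotient (x i) :=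
    { toFun := fun v i => Submodule.quotEquivOfEq _ _ (hx i) (v i)
      map_add' := fun v w => by ext; simp
      map_smul' := fun r v => by ext; simp
      invFun := fun v i =>
        if h : e i ≠ 0 then (Submodule.quotEquivOfEq _ _ (hx ⟨i, h⟩)).symm (v ⟨i, h⟩)
        else 0
      left_inv := fun v => by
        funext i
        by_cases h : e i ≠ 0
        · simp [h]
        · have := hsub ⟨i, h⟩
          exact Subsingleton.elim _ _
      right_inv := fun v => by
        funext i
        simp [i.2] }
  obtain ⟨S, ⟨g₃⟩⟩ := exists_elementaryModule_equiv x
  let G := g₁.trans (g₂.trans g₃)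
  refine ⟨S, (Module.AEval'.of (Matrix.toLin' A)).trans (G.restrictScalars F), fun v => ?_⟩
  simp only [LinearEquiv.trans_apply, LinearEquiv.restrictScalars_apply]
  rw [← map_smul, Module.AEval'.X_smul_of, Matrix.toLin'_apply]

lemma natCard_torsion_self [Finite F] {p : F[X]} (hp : p ≠ 0) {k e : ℕ} (hk : k ≤ e) :
    Nat.card {x : F[X] ⧸ Ideal.span {p ^ e} // p ^ k • x = 0} =
      Nat.card F ^ (k * p.natDegree) := by
  let φ := LinearMap.lsmul F[X] (F[X] ⧸ Ideal.span {p ^ e}) (p ^ k)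
  let ψ := φ ∘ₗ (Ideal.span {p ^ e}).mkQ
  have hker : LinearMap.ker ψ = Ideal.span {p ^ (e - k)} := by
    ext r
    have : ψ r = Ideal.Quotient.mk _ (p ^ k * r) := rfl
    rw [LinearMap.mem_ker, this, Ideal.Quotient.eq_zero_iff_mem, Ideal.mem_span_singleton,
      Ideal.mem_span_singleton, ← Nat.add_sub_cancel' hk, pow_add,
      mul_dvd_mul_iff_left (pow_ne_zero _ hp), Nat.add_sub_cancel_left]
  have hrange : LinearMap.range ψ = LinearMap.range φ :=
    LinearMap.range_comp_of_range_eq_top _ (Submodule.range_mkQ _)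
  have h₁ : Nat.card (LinearMap.range φ) = Nat.card F ^ ((e - k) * p.natDegree) := by
    rw [← hrange, ← Nat.card_congr ψ.quotKerEquivRange.toEquiv, hker,
      natCard_quotient_span (pow_ne_zero _ hp), natDegree_pow]
  have h₂ := Submodule.card_eq_card_quotient_mul_card (LinearMap.ker φ)
  rw [Nat.card_congr φ.quotKerEquivRange.toEquiv, h₁, natCard_quotient_span (pow_ne_zero _ hp),
    natDegree_pow] at h₂
  have h₃ : Nat.card {x : F[X] ⧸ Ideal.span {p ^ e} // p ^ k • x = 0} =
    Nat.card (LinearMap.ker φ) := rfl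
  have hq : 0 < Nat.card F := Nat.card_pos
  rw [h₃]
  refine Nat.eq_of_mul_eq_mul_left (pow_pos hq ((e - k) * p.natDegree)) ?_
  rw [← pow_add, ← add_mul, Nat.sub_add_cancel hk, h₂, mul_comm]

open scoped Classical in
lemma natCard_torsion_primaryQuotient [Finite F] (p : MonicIrreducible F) (k : ℕ)
    (y : ℕ × MonicIrreducible F) :
    Nat.card {x : PrimaryQuotient y // (p : F[X]) ^ k • x = 0} =
      Nat.card F ^ (p.1.natDegree * if y.2 = p then min k (y.1 + 1) else 0) := by
  obtain ⟨e, r⟩ := y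
  split_ifs with h
  · dsimp only at h
    subst h
    rcases le_total k (e + 1) with hk | hk
    · rw [natCard_torsion_self r.2.2.ne_zero hk, min_eq_left hk, mul_comm]
    · rw [min_eq_right hk, mul_comm, ← natCard_torsion_self r.2.2.ne_zero le_rfl]
      have hz (j : ℕ) (hj : e + 1 ≤ j) (x : PrimaryQuotient (e, r)) : (r : F[X]) ^ j • x = 0 := by
        obtain ⟨x, rfl⟩ := Ideal.Quotient.mk_surjective x
        change Ideal.Quotient.mk _ ((r : F[X]) ^ j * x) = 0
        rw [Ideal.Quotient.eq_zero_iff_mem, Ideal.mem_span_singleton]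
        exact (pow_dvd_pow _ hj).mul_right _
      refine Nat.card_congr (Equiv.subtypeEquivRight fun x => ?_)
      exact iff_of_true (hz _ hk x) (hz _ le_rfl x)
  · rw [mul_zero, pow_zero, Nat.card_eq_one_iff_unique]
    refine ⟨⟨?_⟩, ⟨0, smul_zero _⟩⟩
    suffices H : ∀ x : PrimaryQuotient (e, r), (p : F[X]) ^ k • x = 0 → x = 0 by
      rintro ⟨x, hx⟩ ⟨y, hy⟩
      simp [H x hx, H y hy]
    intro x hx
    obtain ⟨x, rfl⟩ := Ideal.Quotient.mk_surjective x
    change Ideal.Quotient.mk _ ((p : F[X]) ^ k * x) = 0 at hx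
    rw [Ideal.Quotient.eq_zero_iff_mem, Ideal.mem_span_singleton] at hx ⊢
    have hc : IsCoprime (r : F[X]) p := by
      refine (r.2.2.coprime_iff_not_dvd).2 fun hd => h (Subtype.ext ?_)
      exact eq_of_monic_of_associated r.2.1 p.2.1 (r.2.2.associated_of_dvd p.2.2 hd)
    exact hc.pow.dvd_of_dvd_mul_left hx

open scoped Classical in
lemma natCard_torsion_elementaryModule [Finite F] (p : MonicIrreducible F) (k : ℕ)
    (S : Multiset (ℕ × MonicIrreducible F)) :
    Nat.card {x : ElementaryModule S // (p : F[X]) ^ k • x = 0} =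
      Nat.card F ^ (p.1.natDegree *
        (S.map fun y => if y.2 = p then min k (y.1 + 1) else 0).sum) := by
  have h₁ : Nat.card {x : ElementaryModule S // (p : F[X]) ^ k • x = 0} =
      Nat.card (∀ y : S, {x : PrimaryQuotient y.1 // (p : F[X]) ^ k • x = 0}) := by
    have h₂ (x : ElementaryModule S) :
        (p : F[X]) ^ k • x = 0 ↔ ∀ y : S, (p : F[X]) ^ k • x y = 0 := funext_iff
    refine Nat.card_congr ((Equiv.subtypeEquivRight h₂).trans ?_)
    exact Equiv.subtypePiEquivPi (p := fun (y : S) (x : PrimaryQuotient y.1) =>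
      (p : F[X]) ^ k • x = 0)
  rw [h₁, Nat.card_pi]
  simp_rw [natCard_torsion_primaryQuotient, pow_mul]
  exact prod_pow_eq_pow_sum_map S (fun y => if y.2 = p then min k (y.1 + 1) else 0) _

lemma eq_of_sum_map_min_eq {α : Type*} [DecidableEq α] {S T : Multiset (ℕ × α)}
    (h : ∀ (a : α) (k : ℕ), (S.map fun y => if y.2 = a then min k (y.1 + 1) else 0).sum =
      (T.map fun y => if y.2 = a then min k (y.1 + 1) else 0).sum) : S = T := by
  have hU (U : Multiset (ℕ × α)) (a : α) (k : ℕ) :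
      (U.map fun y => if y.2 = a then min (k + 2) (y.1 + 1) else 0).sum +
        (U.map fun y => if y.2 = a then min k (y.1 + 1) else 0).sum + U.count (k, a) =
      2 * (U.map fun y => if y.2 = a then min (k + 1) (y.1 + 1) else 0).sum := by
    induction U using Multiset.induction_on with
    | empty => simp
    | cons y U ih =>
      obtain ⟨j, b⟩ := y
      simp only [Multiset.map_cons, Multiset.sum_cons, Multiset.count_cons, Prod.mk.injEq]
      by_cases hb : b = a
      · by_cases hj : k = j
        · simp only [hb, hj, and_self, if_true] at ih ⊢
          grind
        · simp only [hb, hj, false_and, if_true, if_false] at ih ⊢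
          grind
      · simp only [hb, Ne.symm hb, and_false, if_false] at ih ⊢
        lia
  ext ⟨k, a⟩
  have h₁ := hU S a k
  have h₂ := hU T a k
  rw [h a, h a, h a] at h₁
  lia

lemma smul_comm_of_X_smul {M N : Type*} [AddCommGroup M] [AddCommGroup N] [Module F M]
    [Module F N] [Module F[X] M] [Module F[X] N] [IsScalarTower F F[X] M] [IsScalarTower F F[X] N]
    (e : M →ₗ[F] N) (he : ∀ v, e ((X : F[X]) • v) = (X : F[X]) • e v) (f : F[X]) (v : M) :
    e (f • v) = f • e v := by
  have hC (a : F) : (C a : F[X]) = a • 1 := by rw [smul_eq_C_mul, mul_one]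
  induction f using Polynomial.induction_on' generalizing v with
  | add f g hf hg => simp [add_smul, hf, hg]
  | monomial n a =>
    induction n generalizing v with
    | zero => simp [hC]
    | succ n ih => rw [← monomial_mul_X, mul_smul, ih, he, mul_smul]

lemma HasElementaryDivisors.unique [Finite F] {n : ℕ} {A : Matrix (Fin n) (Fin n) F}
    {S T : Multiset (ℕ × MonicIrreducible F)} (hS : HasElementaryDivisors A S)
    (hT : HasElementaryDivisors A T) : S = T := by
  classical
  obtain ⟨e, he⟩ := hS
  obtain ⟨f, hf⟩ := hT
  let g := e.symm.trans f
  have hg (r : F[X]) (v : ElementaryModule S) : g (r • v) = r • g v := by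
    refine smul_comm_of_X_smul g.toLinearMap (fun v => ?_) r v
    obtain ⟨v, rfl⟩ := e.surjective v
    simp [g, ← he, ← hf]
  refine eq_of_sum_map_min_eq fun p k => ?_
  have hcard : Nat.card {x : ElementaryModule S // (p : F[X]) ^ k • x = 0} =
      Nat.card {x : ElementaryModule T // (p : F[X]) ^ k • x = 0} := by
    refine Nat.card_congr (g.toEquiv.subtypeEquiv fun v => ?_)
    change _ ↔ _ • g v = 0
    rw [← hg, LinearEquiv.map_eq_zero_iff]
  rw [natCard_torsion_elementaryModule, natCard_torsion_elementaryModule] at hcard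
  exact Nat.eq_of_mul_eq_mul_left p.2.2.natDegree_pos
    (Nat.pow_right_injective (Finite.one_lt_card (α := F)) hcard)

end Divisors

section Counting

variable {F : Type} [Field F]

lemma natCard_monic_natDegree_eq [Finite F] (d : ℕ) :
    Nat.card {f : F[X] // f.Monic ∧ f.natDegree = d} = Nat.card F ^ d := by
  rw [Nat.card_congr ((monicEquivDegreeLT d).trans (degreeLTEquiv F d).toEquiv), Nat.card_fun,
    Nat.card_fin]

/-- The total degree of a multiset of monic irreducible polynomials. -/
def irrDegree (T : Multiset (MonicIrreducible F)) : ℕ := (T.map fun p => p.1.natDegree).sum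

lemma irrDegree_add (S T : Multiset (MonicIrreducible F)) :
    irrDegree (S + T) = irrDegree S + irrDegree T := by simp [irrDegree]

lemma irrDegree_eq_zero_iff {T : Multiset (MonicIrreducible F)} : irrDegree T = 0 ↔ T = 0 := by
  refine ⟨fun h => ?_, fun h => by simp [h, irrDegree]⟩
  induction T using Multiset.induction_on with
  | empty => rfl
  | cons p T _ =>
    have := p.2.2.natDegree_pos
    simp only [irrDegree, Multiset.map_cons, Multiset.sum_cons] at h
    lia

open UniqueFactorizationMonoid in
/-- Unique factorization of monic polynomials. -/
noncomputable def multisetEquivMonic :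
    Multiset (MonicIrreducible F) ≃ {f : F[X] // f.Monic} := by
  classical
  refine Equiv.ofBijective (fun T => ⟨(T.map Subtype.val).prod,
    monic_multiset_prod_of_monic T Subtype.val fun p _ => p.2.1⟩) ⟨fun S T h => ?_, fun f => ?_⟩
  · have key (U : Multiset (MonicIrreducible F)) :
        normalizedFactors (U.map Subtype.val).prod = U.map Subtype.val := by
      rw [normalizedFactors_multiset_prod, Multiset.map_map]
      · have (p : MonicIrreducible F) : normalizedFactors p.1 = {p.1} := by
          rw [normalizedFactors_irreducible p.2.2, p.2.1.normalize_eq_self]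
        simp only [Function.comp_def, this]
        rw [← Multiset.sum_map_singleton (U.map Subtype.val), Multiset.map_map]
        rfl
      · intro h0
        obtain ⟨p, -, hp⟩ := Multiset.mem_map.1 h0
        exact p.2.2.ne_zero hp
    have h' := congrArg normalizedFactors (congrArg Subtype.val h)
    simp only [key] at h'
    exact Multiset.map_injective Subtype.val_injective h'
  · have hmem (p) (hp : p ∈ normalizedFactors f.1) : p.Monic ∧ Irreducible p := by
      refine ⟨?_, irreducible_of_normalized_factor p hp⟩
      rw [← normalize_normalized_factor p hp]
      exact monic_normalize (irreducible_of_normalized_factor p hp).ne_zero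
    lift normalizedFactors f.1 to Multiset (MonicIrreducible F) using hmem with T hT
    refine ⟨T, Subtype.ext ?_⟩
    change (T.map Subtype.val).prod = _
    rw [hT, prod_normalizedFactors_eq f.2.ne_zero, f.2.normalize_eq_self]

lemma natDegree_multisetEquivMonic (T : Multiset (MonicIrreducible F)) :
    (multisetEquivMonic T).1.natDegree = irrDegree T := by
  change (T.map Subtype.val).prod.natDegree = _
  rw [natDegree_multiset_prod_of_monic, Multiset.map_map]
  · rfl
  · intro f hf
    obtain ⟨p, -, rfl⟩ := Multiset.mem_map.1 hf
    exact p.2.1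

lemma natCard_irrDegree_eq [Finite F] (d : ℕ) :
    Nat.card {T : Multiset (MonicIrreducible F) // irrDegree T = d} = Nat.card F ^ d := by
  rw [← natCard_monic_natDegree_eq]
  refine Nat.card_congr ((multisetEquivMonic.subtypeEquiv fun T => ?_).trans
    (Equiv.subtypeSubtypeEquivSubtypeInter Polynomial.Monic fun f : F[X] => f.natDegree = d))
  rw [natDegree_multisetEquivMonic]

open scoped Classical in
/-- A multiset of elementary divisors, split according to the exponents. -/
noncomputable def multisetProdEquiv {α : Type*} : Multiset (ℕ × α) ≃+ (ℕ →₀ Multiset α) :=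
  (Multiset.toFinsupp.trans Finsupp.curryAddEquiv).trans
    (Finsupp.mapRange.addEquiv Multiset.toFinsupp.symm)

lemma multisetProdEquiv_singleton {α : Type*} (x : ℕ × α) :
    multisetProdEquiv {x} = Finsupp.single x.1 {x.2} := by
  classical
  obtain ⟨i, a⟩ := x
  simp [multisetProdEquiv, Finsupp.curryAddEquiv]

lemma totalDegree_eq_sum (S : Multiset (ℕ × MonicIrreducible F)) :
    totalDegree S = (multisetProdEquiv S).sum fun i T => (i + 1) * irrDegree T := by
  induction S using Multiset.induction_on with
  | empty => simp [totalDegree]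
  | cons x S ih =>
    rw [← Multiset.singleton_add, map_add, Finsupp.sum_add_index', ← ih,
      multisetProdEquiv_singleton, Finsupp.sum_single_index]
    · simp [totalDegree, irrDegree]
    · simp [irrDegree]
    · simp [irrDegree]
    · simp [irrDegree_add, mul_add]

/-- The degree profile of a family of multisets of monic irreducible polynomials. -/
noncomputable def degreeProfile (g : ℕ →₀ Multiset (MonicIrreducible F)) : ℕ →₀ ℕ :=
  g.mapRange irrDegree (irrDegree_eq_zero_iff.2 rfl)

lemma natCard_degreeProfile_eq [Finite F] (d : ℕ →₀ ℕ) :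
    Nat.card {g : ℕ →₀ Multiset (MonicIrreducible F) // degreeProfile g = d} =
      Nat.card F ^ d.sum fun _ k => k := by
  classical
  have hfin (k : ℕ) : Finite {T : Multiset (MonicIrreducible F) // irrDegree T = k} := by
    apply Nat.finite_of_card_ne_zero
    rw [natCard_irrDegree_eq]
    exact pow_ne_zero _ Nat.card_pos.ne'
  have hft (k : ℕ) := Fintype.ofFinite {T : Multiset (MonicIrreducible F) // irrDegree T = k}
  let s (k : ℕ) : Finset (Multiset (MonicIrreducible F)) :=
    Finset.univ.map (Function.Embedding.subtype fun T => irrDegree T = k)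
  have hmem (k : ℕ) (T : Multiset (MonicIrreducible F)) : T ∈ s k ↔ irrDegree T = k := by simp [s]
  have hs (k : ℕ) : (s k).card = Nat.card F ^ k := by
    rw [← natCard_irrDegree_eq, Finset.card_map, Finset.card_univ, Nat.card_eq_fintype_card]
  have key (g : ℕ →₀ Multiset (MonicIrreducible F)) :
      degreeProfile g = d ↔ g ∈ d.support.finsupp fun i => s (d i) := by
    rw [Finset.mem_finsupp_iff, Finsupp.ext_iff]
    simp only [degreeProfile, Finsupp.mapRange_apply, hmem]
    refine ⟨fun h => ⟨fun i hi => ?_, fun i _ => h i⟩, fun h i => ?_⟩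
    · rw [Finsupp.mem_support_iff, ← h i, Ne, irrDegree_eq_zero_iff]
      exact Finsupp.mem_support_iff.1 hi
    · by_cases hi : i ∈ d.support
      · exact h.2 i hi
      · rw [Finsupp.notMem_support_iff.1 fun H => hi (h.1 H), Finsupp.notMem_support_iff.1 hi,
          irrDegree_eq_zero_iff]
  rw [Nat.card_congr (Equiv.subtypeEquivRight key), Nat.card_eq_fintype_card, Fintype.card_coe,
    Finset.card_finsupp]
  simp_rw [hs]
  rw [Finset.prod_pow_eq_pow_sum]
  rfl

lemma finite_finsupp_sum_eq (n : ℕ) :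
    {d : ℕ →₀ ℕ | (d.sum fun i k => (i + 1) * k) = n}.Finite := by
  refine ((Finset.range n).finsupp fun _ => Finset.range (n + 1)).finite_toSet.subset fun d hd => ?_
  have hle (i : ℕ) : (i + 1) * d i ≤ n := by
    by_cases hi : i ∈ d.support
    · rw [← hd]
      exact Finset.single_le_sum (f := fun i => (i + 1) * d i) (fun _ _ => Nat.zero_le _) hi
    · simp [Finsupp.notMem_support_iff.1 hi]
  refine Finset.mem_coe.2 (Finset.mem_finsupp_iff.2 ⟨fun i hi => ?_, fun i _ => ?_⟩)
  · have h₁ := Nat.pos_of_ne_zero (Finsupp.mem_support_iff.1 hi)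
    have h₂ := Nat.le_mul_of_pos_right (i + 1) h₁
    rw [Finset.mem_range]
    exact h₂.trans (hle i)
  · rw [Finset.mem_range]
    exact Nat.lt_succ_of_le ((Nat.le_mul_of_pos_left _ i.succ_pos).trans (hle i))

lemma natCard_totalDegree_eq [Finite F] (n : ℕ) :
    Nat.card {S : Multiset (ℕ × MonicIrreducible F) // totalDegree S = n} =
      ∑ d ∈ (finite_finsupp_sum_eq n).toFinset, Nat.card F ^ d.sum fun _ k => k := by
  have hprofile (g : ℕ →₀ Multiset (MonicIrreducible F)) :
      (g.sum fun i T => (i + 1) * irrDegree T) =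
        (degreeProfile g).sum fun i k => (i + 1) * k := by
    rw [degreeProfile, Finsupp.sum_mapRange_index fun _ => mul_zero _]
  let D := (finite_finsupp_sum_eq n).toFinset
  have hD (d : ℕ →₀ ℕ) : d ∈ D ↔ (d.sum fun i k => (i + 1) * k) = n := by simp [D]
  have hfin (d : ℕ →₀ ℕ) :
      Finite {g : ℕ →₀ Multiset (MonicIrreducible F) // degreeProfile g = d} := by
    apply Nat.finite_of_card_ne_zero
    rw [natCard_degreeProfile_eq]
    exact pow_ne_zero _ Nat.card_pos.ne'
  let e : {S : Multiset (ℕ × MonicIrreducible F) // totalDegree S = n} ≃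
      Σ d : D, {g : ℕ →₀ Multiset (MonicIrreducible F) // degreeProfile g = d} :=
    (multisetProdEquiv.toEquiv.subtypeEquiv fun S => by
      rw [totalDegree_eq_sum, hprofile, ← hD]; rfl).trans
    (Equiv.sigmaSubtypeFiberEquivSubtype (p := fun g => degreeProfile g ∈ D) degreeProfile
      fun g => Iff.rfl).symm
  rw [Nat.card_congr e, Nat.card_sigma]
  simp_rw [natCard_degreeProfile_eq]
  exact Finset.sum_coe_sort D fun d => Nat.card F ^ d.sum fun _ k => k

lemma conjClassCount_eq_natCard [Fintype F] (n : ℕ) :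
    conjClassCount F n =
      Nat.card {S : Multiset (ℕ × MonicIrreducible F) // totalDegree S = n} := by
  choose φ hφ using fun A : Matrix (Fin n) (Fin n) F => exists_elementaryDivisors A
  refine Nat.card_congr (Equiv.ofBijective (Quot.lift (fun A => ⟨φ A, (hφ A).totalDegree_eq⟩)
    fun A B h => Subtype.ext ((hφ A).conj h |>.unique (hφ B))) ⟨?_, fun S => ?_⟩)
  · rintro ⟨A⟩ ⟨B⟩ h
    have h' : φ A = φ B := congrArg Subtype.val h
    exact Quot.sound ((hφ A).exists_conj (h' ▸ hφ B))
  · obtain ⟨A, hA⟩ := exists_hasElementaryDivisors S.1 S.2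
    exact ⟨Quot.mk _ A, Subtype.ext ((hφ A).unique hA)⟩

end Counting

section Analysis

open Filter Topology

lemma Finset.prod_sum_eq_sum_finsupp {ι M : Type*} [CommSemiring M] (s : Finset ι)
    (t : ι → Finset ℕ) (h : ι → ℕ → M) (h0 : ∀ i, h i 0 = 1) :
    ∏ i ∈ s, ∑ k ∈ t i, h i k = ∑ c ∈ s.finsupp t, c.prod h := by
  classical
  rw [Finset.prod_sum]
  unfold Finset.finsupp
  rw [Finset.sum_map]
  refine Finset.sum_congr (by congr!) fun p _ => ?_
  change _ = (Finsupp.indicator s p).prod h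
  rw [Finsupp.prod_of_support_subset _ (Finsupp.support_indicator_subset s p) h fun i _ => h0 i,
    ← Finset.prod_attach s]
  refine Finset.prod_congr rfl fun i _ => ?_
  simp [Finsupp.indicator_of_mem i.2]

lemma tendsto_finsupp_range_atTop :
    Tendsto (fun N : ℕ => (Finset.range N).finsupp fun _ => Finset.range N) atTop atTop := by
  refine tendsto_atTop_finset_of_monotone (fun M N h c => ?_) fun c => ?_
  · simp only [Finset.mem_finsupp_iff, Finset.mem_range]
    rintro ⟨h₁, h₂⟩
    refine ⟨h₁.trans (Finset.range_mono h), fun i _ => ?_⟩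
    by_cases hi : i ∈ c.support
    · exact (h₂ i (Finset.mem_range.1 (h₁ hi))).trans_le h
    · rw [Finsupp.notMem_support_iff.1 hi]
      lia
  · refine ⟨c.support.sup id + c.support.sup c + 1, Finset.mem_finsupp_iff.2 ⟨fun i hi => ?_,
      fun i _ => ?_⟩⟩
    · have := Finset.le_sup (f := id) hi
      rw [Finset.mem_range]
      simp only [id] at this
      lia
    · rw [Finset.mem_range]
      by_cases hi : i ∈ c.support
      · have := Finset.le_sup (f := c) hi
        lia
      · rw [Finsupp.notMem_support_iff.1 hi]
        lia

/-- A sum of nonnegative reals that converges along one exhausting sequence of finite sets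
converges. -/
lemma hasSum_of_tendsto_sum_of_nonneg {ι : Type*} {f : ι → ℝ} {a : ℝ} (hf : ∀ i, 0 ≤ f i)
    {s : ℕ → Finset ι} (hs : Tendsto s atTop atTop)
    (h : Tendsto (fun n => ∑ i ∈ s n, f i) atTop (𝓝 a)) : HasSum f a := by
  have hsum : Summable f := by
    refine summable_of_sum_le (c := a) hf fun u => ?_
    refine ge_of_tendsto h ?_
    filter_upwards [hs.eventually_ge_atTop u] with n hn
    exact Finset.sum_le_sum_of_subset_of_nonneg hn fun i _ _ => hf i
  have := hsum.hasSum.comp hs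
  rw [← tendsto_nhds_unique this h]
  exact hsum.hasSum

lemma tendsto_prod_range_one_sub {x : ℝ} (hx0 : 0 ≤ x) (hx1 : x < 1) :
    Tendsto (fun N : ℕ => ∏ i ∈ Finset.range N, (1 - x ^ (i + 1))) atTop
      (𝓝 (∏' i : ℕ, (1 - x ^ (i + 1)))) := by
  have hs : Summable fun i : ℕ => -x ^ (i + 1) :=
    ((summable_nat_add_iff 1).2 (summable_geometric_of_lt_one hx0 hx1)).neg
  have := (Real.multipliable_one_add_of_summable hs).hasProd.tendsto_prod_nat
  simpa only [← sub_eq_add_neg] using this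

lemma tprod_one_sub_pow_ne_zero {x : ℝ} (hx0 : 0 ≤ x) (hx1 : x < 1) :
    ∏' i : ℕ, (1 - x ^ (i + 1)) ≠ 0 := by
  have hs : Summable fun i : ℕ => -x ^ (i + 1) :=
    ((summable_nat_add_iff 1).2 (summable_geometric_of_lt_one hx0 hx1)).neg
  have := tprod_one_add_ne_zero_of_summable (R := ℝ) (f := fun i : ℕ => -x ^ (i + 1))
    (fun i => by linarith [pow_lt_one₀ hx0 hx1 i.add_one_ne_zero]) hs.norm
  simpa only [← sub_eq_add_neg] using this

lemma tendsto_prod_range_one_sub_pow_mul {x : ℝ} (hx0 : 0 ≤ x) (hx1 : x < 1) :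
    Tendsto (fun N : ℕ => ∏ i ∈ Finset.range N, (1 - x ^ ((i + 1) * N))) atTop (𝓝 1) := by
  have hpow (i N : ℕ) : x ^ ((i + 1) * N) ≤ x ^ N :=
    pow_le_pow_of_le_one hx0 hx1.le (Nat.le_mul_of_pos_left N i.succ_pos)
  have hpow1 (N : ℕ) : x ^ N ≤ 1 := pow_le_one₀ hx0 hx1.le
  refine tendsto_of_tendsto_of_tendsto_of_le_of_le (g := fun N : ℕ => 1 - N * x ^ N)
    (h := fun _ => 1) ?_ tendsto_const_nhds (fun N => ?_) (fun N => ?_)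
  · simpa using (tendsto_self_mul_const_pow_of_lt_one hx0 hx1).const_sub 1
  · calc 1 - N * x ^ N = 1 + N * (-x ^ N) := by ring
      _ ≤ (1 + -x ^ N) ^ N := one_add_mul_le_pow (by linarith [hpow1 N]) N
      _ = ∏ i ∈ Finset.range N, (1 - x ^ N) := by simp [sub_eq_add_neg]
      _ ≤ _ := Finset.prod_le_prod (fun i _ => by linarith [hpow1 N])
        fun i _ => by linarith [hpow i N]
  · exact Finset.prod_le_one (fun i _ => by linarith [hpow1 N, hpow i N])
      fun i _ => by linarith [pow_nonneg hx0 ((i + 1) * N)]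

/-- The generating function of partitions, summed over multiplicity functions. -/
lemma hasSum_partition {x : ℝ} (hx0 : 0 ≤ x) (hx1 : x < 1) :
    HasSum (fun c : ℕ →₀ ℕ => x ^ c.sum fun i k => (i + 1) * k)
      (∏' i : ℕ, (1 - x ^ (i + 1)))⁻¹ := by
  refine hasSum_of_tendsto_sum_of_nonneg (fun c => pow_nonneg hx0 _)
    tendsto_finsupp_range_atTop ?_
  have h₁ (N : ℕ) : ∑ c ∈ (Finset.range N).finsupp fun _ => Finset.range N,
      x ^ (c.sum fun i k => (i + 1) * k) =
      (∏ i ∈ Finset.range N, (1 - x ^ ((i + 1) * N))) *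
        (∏ i ∈ Finset.range N, (1 - x ^ (i + 1)))⁻¹ := by
    have h₂ (c : ℕ →₀ ℕ) : x ^ (c.sum fun i k => (i + 1) * k) =
        c.prod fun i k => (x ^ (i + 1)) ^ k := by
      simp only [Finsupp.sum, Finsupp.prod, ← Finset.prod_pow_eq_pow_sum, pow_mul]
    simp_rw [h₂]
    rw [← Finset.prod_sum_eq_sum_finsupp _ _ _ fun i => pow_zero _, ← Finset.prod_inv_distrib,
      ← Finset.prod_mul_distrib]
    refine Finset.prod_congr rfl fun i _ => ?_
    have hne : x ^ (i + 1) ≠ 1 := (pow_lt_one₀ hx0 hx1 (Nat.succ_ne_zero i)).ne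
    rw [geom_sum_eq hne, pow_mul, ← neg_div_neg_eq, neg_sub, neg_sub, div_eq_mul_inv]
  simp_rw [h₁]
  simpa using (tendsto_prod_range_one_sub_pow_mul hx0 hx1).mul
    ((tendsto_prod_range_one_sub hx0 hx1).inv₀ (tprod_one_sub_pow_ne_zero hx0 hx1))

end Analysis

section Limit

/-- Shift a multiplicity function by one and put `m` at `0`. -/
noncomputable def consMultiplicity (m : ℕ) (c : ℕ →₀ ℕ) : ℕ →₀ ℕ :=
  Finsupp.single 0 m + c.mapDomain Nat.succ

lemma consMultiplicity_zero (m : ℕ) (c : ℕ →₀ ℕ) : consMultiplicity m c 0 = m := by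
  simp [consMultiplicity, Finsupp.mapDomain_of_notMem_range]

lemma consMultiplicity_succ (m : ℕ) (c : ℕ →₀ ℕ) (i : ℕ) :
    consMultiplicity m c (i + 1) = c i := by
  simp [consMultiplicity, Finsupp.mapDomain_apply Nat.succ_injective]

lemma consMultiplicity_sum (m : ℕ) (c : ℕ →₀ ℕ) (w : ℕ → ℕ) :
    ((consMultiplicity m c).sum fun i k => w i * k) = w 0 * m + c.sum fun i k => w (i + 1) * k := by
  rw [consMultiplicity, Finsupp.sum_add_index', Finsupp.sum_single_index,
    Finsupp.sum_mapDomain_index]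
  all_goals simp [mul_add]

lemma exists_eq_consMultiplicity (d : ℕ →₀ ℕ) : ∃ m c, d = consMultiplicity m c := by
  refine ⟨d 0, d.comapDomain Nat.succ Nat.succ_injective.injOn, ?_⟩
  ext i
  cases i with
  | zero => rw [consMultiplicity_zero]
  | succ i => rw [consMultiplicity_succ, Finsupp.comapDomain_apply]

/-- The finite set of multiplicity functions `c` with `∑ (i + 2) * c i ≤ n`. -/
noncomputable def boundedMultiplicity (n : ℕ) : Finset (ℕ →₀ ℕ) :=
  (finite_finsupp_sum_eq n).toFinset.image fun d =>
    d.comapDomain Nat.succ Nat.succ_injective.injOn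

lemma comapDomain_consMultiplicity (m : ℕ) (c : ℕ →₀ ℕ) :
    (consMultiplicity m c).comapDomain Nat.succ Nat.succ_injective.injOn = c := by
  ext i
  rw [Finsupp.comapDomain_apply, Nat.succ_eq_add_one, consMultiplicity_succ]

lemma mem_boundedMultiplicity {n : ℕ} {c : ℕ →₀ ℕ} :
    c ∈ boundedMultiplicity n ↔ (c.sum fun i k => (i + 2) * k) ≤ n := by
  simp only [boundedMultiplicity, Finset.mem_image, Set.Finite.mem_toFinset]
  constructor
  · rintro ⟨d, hd, rfl⟩
    obtain ⟨m, c, rfl⟩ := exists_eq_consMultiplicity d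
    change ((consMultiplicity m c).sum fun i k => (i + 1) * k) = n at hd
    rw [consMultiplicity_sum m c fun i => i + 1] at hd
    rw [comapDomain_consMultiplicity]
    lia
  · intro h
    refine ⟨consMultiplicity (n - c.sum fun i k => (i + 2) * k) c, ?_,
      comapDomain_consMultiplicity _ _⟩
    change (Finsupp.sum _ fun i k => (i + 1) * k) = n
    rw [consMultiplicity_sum _ _ fun i => i + 1]
    lia

lemma sum_pow_eq_sum_boundedMultiplicity {q : ℝ} (hq : q ≠ 0) (n : ℕ) :
    (∑ d ∈ (finite_finsupp_sum_eq n).toFinset, q ^ d.sum fun _ k => k) / q ^ n =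
      ∑ c ∈ boundedMultiplicity n, q⁻¹ ^ c.sum fun i k => (i + 1) * k := by
  have hmem {d : ℕ →₀ ℕ} (hd : d ∈ (finite_finsupp_sum_eq n).toFinset) :
      (d.sum fun i k => (i + 1) * k) = n := by
    simpa using hd
  rw [boundedMultiplicity, Finset.sum_image, Finset.sum_div]
  · refine Finset.sum_congr rfl fun d hd => ?_
    replace hd := hmem hd
    obtain ⟨m, c, rfl⟩ := exists_eq_consMultiplicity d
    rw [consMultiplicity_sum m c fun i => i + 1] at hd
    have h₁ := consMultiplicity_sum m c fun _ => 1
    simp only [one_mul] at h₁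
    have h₂ : (c.sum fun i k => (i + 1 + 1) * k) =
        (c.sum fun i k => (i + 1) * k) + c.sum fun _ k => k := by
      rw [← Finsupp.sum_add]
      simp only [add_mul, one_mul]
    have hn : n = (m + c.sum fun _ k => k) + c.sum fun i k => (i + 1) * k := by lia
    rw [comapDomain_consMultiplicity, h₁, hn, pow_add q (m + _), inv_pow, div_mul_eq_div_div,
      div_self (pow_ne_zero _ hq), one_div]
  · intro d hd d' hd' h
    replace hd := hmem hd
    replace hd' := hmem hd'
    obtain ⟨m, c, rfl⟩ := exists_eq_consMultiplicity d
    obtain ⟨m', c', rfl⟩ := exists_eq_consMultiplicity d'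
    simp only [comapDomain_consMultiplicity] at h
    subst h
    rw [consMultiplicity_sum _ _ fun i => i + 1] at hd hd'
    have : m = m' := by lia
    rw [this]

lemma tendsto_boundedMultiplicity_atTop :
    Filter.Tendsto boundedMultiplicity Filter.atTop Filter.atTop :=
  Filter.tendsto_atTop_finset_of_monotone
    (fun _ _ h _ hc => mem_boundedMultiplicity.2 ((mem_boundedMultiplicity.1 hc).trans h))
    fun _ => ⟨_, mem_boundedMultiplicity.2 le_rfl⟩

end Limit

theorem conjClassCount_div_tendsto {F : Type} [Field F] [Fintype F] (q : ℕ)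
    (hq : Fintype.card F = q) :
    Filter.Tendsto (fun n : ℕ => (conjClassCount F n : ℝ) / (q : ℝ) ^ n) Filter.atTop
      (nhds ((∏' r : ℕ, (1 - ((q : ℝ))⁻¹ ^ (r + 1)))⁻¹)) := by
  have hq1 : (1 : ℝ) < q := by
    rw [← hq]
    exact_mod_cast Fintype.one_lt_card
  have hq0 : (0 : ℝ) < q := one_pos.trans hq1
  refine ((hasSum_partition (inv_nonneg.2 hq0.le) (inv_lt_one_of_one_lt₀ hq1)).comp
    tendsto_boundedMultiplicity_atTop).congr fun n => ?_
  rw [conjClassCount_eq_natCard, natCard_totalDegree_eq, Nat.card_eq_fintype_card, hq]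
  push_cast
  exact (sum_pow_eq_sum_boundedMultiplicity hq0.ne' n).symm
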